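/- Let 𝔤 be a Lie algebra over k, S = S𝔤 its symmetric algebra, a ∈ S, and p ≥ 1. Then the k-linear endomorphism F : S → S given by F(x) = B_p(a, x) is a differential operator of order ≤ p. -/

import Mathlib

noncomputable section

/-- The degree-`n` homogeneous component `S^n` of the symmetric algebra:
the span of `n`-fold products of elements of `𝔤` (realized as the `n`-th power of the
submodule `ι(𝔤) ⊆ S`). -/
def Sdeg (k : Type) [Field k] (L : Type) [LieRing L] [LieAlgebra k L]
    (S : Type) [CommRing S] [Algebra k S] (ι : L →ₗ[k] S) (n : ℕ) : Submodule k S :=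
  (LinearMap.range ι) ^ n

/-- `(S, ι)` is a model of the symmetric algebra of the Lie algebra `L`:
`S` is commutative and generated as a `k`-algebra by the image of `ι`. -/
def IsSymmAlg (k : Type) [Field k] (L : Type) [LieRing L] [LieAlgebra k L]
    (S : Type) [CommRing S] [Algebra k S] (ι : L →ₗ[k] S) : Prop :=
  Algebra.adjoin k (Set.range ι) = ⊤

/-- `e : S → U𝔤` is the symmetrization map: it sends a monomial `g₁ ⋯ g_p` to
`(1/p!) ∑_{σ ∈ S_p} g_{σ(1)} ⋯ g_{σ(p)}`. -/
def IsSymmetrization (k : Type) [Field k] (L : Type) [LieRing L] [LieAlgebra k L]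
    (S : Type) [CommRing S] [Algebra k S] (ι : L →ₗ[k] S)
    (e : S →ₗ[k] UniversalEnvelopingAlgebra k L) : Prop :=
  ∀ l : List L,
    e (l.map ι).prod = ((l.length.factorial : k)⁻¹) •
      ∑ σ : Equiv.Perm (Fin l.length),
        (List.ofFn fun i => UniversalEnvelopingAlgebra.ι k (l.get (σ i))).prod

/-- `B : ℕ → S →ₗ S →ₗ S` is the family of homogeneous components `B_p` of the product
`B(x,y) = e⁻¹(e(x)e(y))`: each `B p` lowers total degree by `p` (it maps `S^n ⊗ S^m`
to `S^{n+m-p}` and vanishes for `p > n+m`), and on homogeneous elements `x ∈ S^n`,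
`y ∈ S^m` one has `e (∑_{p=0}^{n+m} B p x y) = e x * e y`, i.e.
`e⁻¹(e(x)e(y)) = ∑_p B_p(x,y)`. -/
def IsPBWComponents (k : Type) [Field k] (L : Type) [LieRing L] [LieAlgebra k L]
    (S : Type) [CommRing S] [Algebra k S] (ι : L →ₗ[k] S)
    (e : S →ₗ[k] UniversalEnvelopingAlgebra k L)
    (B : ℕ → S →ₗ[k] S →ₗ[k] S) : Prop :=
  (∀ p n m, ∀ x ∈ Sdeg k L S ι n, ∀ y ∈ Sdeg k L S ι m,
      B p x y ∈ Sdeg k L S ι (n + m - p)) ∧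
  (∀ p n m, n + m < p → ∀ x ∈ Sdeg k L S ι n, ∀ y ∈ Sdeg k L S ι m, B p x y = 0) ∧
  (∀ n m, ∀ x ∈ Sdeg k L S ι n, ∀ y ∈ Sdeg k L S ι m,
      e (∑ p ∈ Finset.range (n + m + 1), B p x y) = e x * e y)


/-- A `k`-linear endomorphism `F` of a commutative associative `k`-algebra `A` is a
differential operator of order `≤ p` if
`∑_{S ⊆ {1,…,p+1}} (-1)^{#S} a_{S^c} F(a_S b) = 0` for all `a_1,…,a_{p+1}, b ∈ A`,
where `a_S` denotes the product of the `a_i` for `i ∈ S`. -/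
def IsDiffOpOrderLE (k : Type) [Field k] (A : Type) [CommRing A] [Algebra k A]
    (p : ℕ) (F : A →ₗ[k] A) : Prop :=
  ∀ (a : Fin (p + 1) → A) (b : A),
    ∑ T : Finset (Fin (p + 1)),
      (-1 : A) ^ T.card * (∏ i ∈ Tᶜ, a i) * F ((∏ i ∈ T, a i) * b) = 0

section PolynomialCurves

variable {k : Type*} [Field k] {V V' V'' : Type*} [AddCommGroup V] [Module k V]
  [AddCommGroup V'] [Module k V'] [AddCommGroup V''] [Module k V'']

/-- Vector-valued polynomial functions of one scalar variable. -/
def polyCurves (k V : Type*) [Field k] [AddCommGroup V] [Module k V] : Submodule k (k → V) :=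
  Submodule.span k (Set.range fun (x : ℕ × V) (t : k) => t ^ x.1 • x.2)

lemma monomial_mem_polyCurves (i : ℕ) (v : V) : (fun t : k => t ^ i • v) ∈ polyCurves k V :=
  Submodule.subset_span ⟨(i, v), rfl⟩

lemma const_mem_polyCurves (v : V) : (fun _ : k => v) ∈ polyCurves k V := by
  simpa using monomial_mem_polyCurves (k := k) 0 v

lemma bilin_mem_polyCurves (B : V →ₗ[k] V' →ₗ[k] V'') {f : k → V} {f' : k → V'}
    (hf : f ∈ polyCurves k V) (hf' : f' ∈ polyCurves k V') :
    (fun t => B (f t) (f' t)) ∈ polyCurves k V'' := by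
  induction hf using Submodule.span_induction with
  | mem f hf =>
    obtain ⟨⟨i, v⟩, rfl⟩ := hf
    induction hf' using Submodule.span_induction with
    | mem f' hf' =>
      obtain ⟨⟨j, w⟩, rfl⟩ := hf'
      convert monomial_mem_polyCurves (k := k) (i + j) (B v w) using 2 with t
      simp [pow_add, mul_smul, smul_comm (t ^ j)]
    | zero => simp only [map_zero, Pi.zero_apply]; exact zero_mem _
    | add f g _ _ hf hg =>
      convert (polyCurves k V'').add_mem hf hg using 1
      ext t
      simp
    | smul c f _ hf =>
      convert (polyCurves k V'').smul_mem c hf using 1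
      ext t
      simp
  | zero => simp only [map_zero, LinearMap.zero_apply, Pi.zero_apply]; exact zero_mem _
  | add f g _ _ hf hg =>
    convert (polyCurves k V'').add_mem hf hg using 1
    ext t
    simp
  | smul c f _ hf =>
    convert (polyCurves k V'').smul_mem c hf using 1
    ext t
    simp

lemma smul_mem_polyCurves {f : k → V} (hf : f ∈ polyCurves k V) :
    (fun t => t • f t) ∈ polyCurves k V := by
  have h : (fun t : k => t) ∈ polyCurves k k := by
    simpa using monomial_mem_polyCurves (k := k) 1 (1 : k)
  simpa using bilin_mem_polyCurves (LinearMap.lsmul k V) h hf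

lemma exists_polynomial_of_mem_polyCurves (φ : V →ₗ[k] k) {f : k → V}
    (hf : f ∈ polyCurves k V) : ∃ q : Polynomial k, ∀ t, φ (f t) = q.eval t := by
  induction hf using Submodule.span_induction with
  | mem f hf =>
    obtain ⟨⟨i, v⟩, rfl⟩ := hf
    exact ⟨Polynomial.C (φ v) * Polynomial.X ^ i, fun t => by simp [mul_comm (φ v)]⟩
  | zero => exact ⟨0, by simp⟩
  | add f g _ _ hf hg =>
    obtain ⟨p, hp⟩ := hf
    obtain ⟨q, hq⟩ := hg
    exact ⟨p + q, by simp [hp, hq]⟩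
  | smul c f _ hf =>
    obtain ⟨p, hp⟩ := hf
    exact ⟨Polynomial.C c * p, fun t => by simp [hp]⟩

/-- The polynomial curve `f` has the expansion `f t = a + t b + O(t²)`. -/
def HasJet (f : k → V) (a b : V) : Prop :=
  ∃ r ∈ polyCurves k V, ∀ t, f t = a + t • b + t ^ 2 • r t

lemma HasJet.const (a : V) : HasJet (fun _ : k => a) a 0 :=
  ⟨0, zero_mem _, by simp⟩

lemma HasJet.line (a b : V) : HasJet (fun t : k => a + t • b) a b :=
  ⟨0, zero_mem _, by simp⟩

lemma HasJet.add {f g : k → V} {a b c d : V} (hf : HasJet f a b) (hg : HasJet g c d) :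
    HasJet (fun t => f t + g t) (a + c) (b + d) := by
  obtain ⟨r, hr, hf⟩ := hf
  obtain ⟨s, hs, hg⟩ := hg
  exact ⟨r + s, add_mem hr hs, fun t => by
    simp only [hf, hg, Pi.add_apply, smul_add]; abel⟩

lemma HasJet.bilin (B : V →ₗ[k] V' →ₗ[k] V'') {f : k → V} {f' : k → V'} {a b : V} {a' b' : V'}
    (hf : HasJet f a b) (hf' : HasJet f' a' b') :
    HasJet (fun t => B (f t) (f' t)) (B a a') (B a b' + B b a') := by
  obtain ⟨r, hr, hf⟩ := hf
  obtain ⟨s, hs, hf'⟩ := hf'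
  have hc := fun v : V => const_mem_polyCurves (k := k) v
  have hc' := fun v : V' => const_mem_polyCurves (k := k) v
  refine ⟨_, add_mem (add_mem (add_mem (bilin_mem_polyCurves B (hc a) hs)
    (bilin_mem_polyCurves B hr (hc' a'))) (bilin_mem_polyCurves B (hc b) (hc' b')))
    (add_mem (smul_mem_polyCurves (add_mem (bilin_mem_polyCurves B (hc b) hs)
    (bilin_mem_polyCurves B hr (hc' b'))))
    (smul_mem_polyCurves (smul_mem_polyCurves (bilin_mem_polyCurves B hr hs)))), fun t => ?_⟩
  simp only [hf, hf', map_add, map_smul, LinearMap.add_apply, LinearMap.smul_apply, Pi.add_apply]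
  module

lemma HasJet.map (φ : V →ₗ[k] V') {f : k → V} {a b : V} (hf : HasJet f a b) :
    HasJet (fun t => φ (f t)) (φ a) (φ b) := by
  simpa using HasJet.bilin (LinearMap.lsmul k V' |>.compr₂ LinearMap.id |>.compl₂ φ)
    (HasJet.const (1 : k)) hf

variable {A : Type*} [Ring A] [Algebra k A]

lemma HasJet.mul {f g : k → A} {a b c d : A} (hf : HasJet f a b) (hg : HasJet g c d) :
    HasJet (fun t => f t * g t) (a * c) (a * d + b * c) :=
  HasJet.bilin (LinearMap.mul k A) hf hg

lemma HasJet.pow {f : k → A} {a b : A} (hf : HasJet f a b) (n : ℕ) :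
    HasJet (fun t => f t ^ n) (a ^ n) (∑ i ∈ Finset.range n, a ^ i * b * a ^ (n - 1 - i)) := by
  induction n with
  | zero => simpa using HasJet.const (1 : A)
  | succ n ih =>
    convert ih.mul hf using 1
    · simp only [pow_succ]
    · rw [pow_succ]
    rw [Finset.sum_range_succ, add_comm, Finset.sum_mul]
    congr 1
    · simp
    · refine Finset.sum_congr rfl fun i hi => ?_
      have : n + 1 - 1 - i = (n - 1 - i) + 1 := by have := Finset.mem_range.1 hi; omega
      rw [this, pow_succ, mul_assoc (a ^ i * b)]

lemma HasJet.pow_comm {A : Type*} [CommRing A] [Algebra k A] {f : k → A} {a b : A}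
    (hf : HasJet f a b) (n : ℕ) :
    HasJet (fun t => f t ^ n) (a ^ n) ((n : k) • (a ^ (n - 1) * b)) := by
  convert hf.pow n using 1
  rw [Finset.sum_congr rfl (g := fun _ => a ^ (n - 1) * b)]
  · simp [Nat.cast_smul_eq_nsmul]
  · intro i hi
    have : n - 1 = i + (n - 1 - i) := by have := Finset.mem_range.1 hi; omega
    conv_rhs => rw [this, pow_add]
    ring

lemma HasJet.mem [CharZero k] {f : k → V} {a b : V} (hf : HasJet f a b) (W : Submodule k V)
    (hW : ∀ t, f t ∈ W) : b ∈ W := by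
  obtain ⟨r, hr, hf⟩ := hf
  rw [← Submodule.Quotient.mk_eq_zero, ← Module.forall_dual_apply_eq_zero_iff k]
  intro φ
  obtain ⟨q, hq⟩ := exists_polynomial_of_mem_polyCurves (φ ∘ₗ W.mkQ) hr
  have h0 : Polynomial.C (φ (W.mkQ a)) + Polynomial.X * Polynomial.C (φ (W.mkQ b)) +
      Polynomial.X ^ 2 * q = 0 := by
    refine Polynomial.funext fun t => ?_
    have h := congrArg φ ((Submodule.Quotient.mk_eq_zero W).2 (hW t))
    rw [hf, ← Submodule.mkQ_apply] at h
    have hq' := hq t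
    simp only [LinearMap.comp_apply, Submodule.mkQ_apply] at hq'
    simpa [hq', mul_comm t] using h
  have h1 := congrArg (fun p => Polynomial.coeff p 1) h0
  simpa [Polynomial.coeff_X_pow_mul', Polynomial.coeff_C] using h1

lemma HasJet.unique [CharZero k] {f : k → V} {a b c d : V} (h : HasJet f a b)
    (h' : HasJet f c d) : b = d := by
  have h'' := (h.add (h'.map (-LinearMap.id))).mem ⊥ (by simp)
  simpa [add_neg_eq_zero] using h''

lemma eq_zero_of_sum_pow_smul_eq_zero {T : Set k} (hT : T.Infinite) {N : ℕ} {v : ℕ → V}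
    (h : ∀ t ∈ T, ∑ i ∈ Finset.range N, t ^ i • v i = 0) {i : ℕ} (hi : i < N) : v i = 0 := by
  rw [← Module.forall_dual_apply_eq_zero_iff k]
  intro φ
  have h0 : ∑ i ∈ Finset.range N, Polynomial.C (φ (v i)) * Polynomial.X ^ i = 0 := by
    refine Polynomial.eq_zero_of_infinite_isRoot _ (hT.mono fun t ht => ?_)
    have h1 := congrArg φ (h t ht)
    simpa [Polynomial.IsRoot, Polynomial.eval_finsetSum, mul_comm (φ _)] using h1
  have h1 := congrArg (fun p => Polynomial.coeff p i) h0
  simpa [Polynomial.finsetSum_coeff, Polynomial.coeff_C_mul, Polynomial.coeff_X_pow, hi] using h1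

end PolynomialCurves

section PolynomialMaps

variable {k : Type*} [Field k] {L V V' : Type*} [AddCommGroup L] [Module k L]
  [AddCommGroup V] [Module k V] [AddCommGroup V'] [Module k V']

/-- `φ : L → V` is a homogeneous polynomial map of degree `p`, in the sense that all of its
directional derivatives are homogeneous polynomial maps of degree `p - 1`. -/
def IsPolyMap (k : Type*) [Field k] {L V : Type*} [AddCommGroup L] [Module k L]
    [AddCommGroup V] [Module k V] : ℕ → (L → V) → Prop
  | 0, φ => ∃ c, ∀ h, φ h = c
  | p + 1, φ => ∀ g, ∃ ψ, IsPolyMap k p ψ ∧ ∀ h, HasJet (fun t : k => φ (h + t • g)) (φ h) (ψ h)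

lemma IsPolyMap.map (f : V →ₗ[k] V') : ∀ {p : ℕ} {φ : L → V}, IsPolyMap k p φ →
    IsPolyMap k p (fun h => f (φ h))
  | 0, _, ⟨c, hc⟩ => ⟨f c, fun h => congrArg f (hc h)⟩
  | p + 1, _, hφ => fun g => by
    obtain ⟨ψ, hψ, hj⟩ := hφ g
    exact ⟨_, hψ.map f, fun h => (hj h).map f⟩

lemma IsPolyMap.add : ∀ {p : ℕ} {φ χ : L → V}, IsPolyMap k p φ → IsPolyMap k p χ →
    IsPolyMap k p (fun h => φ h + χ h)
  | 0, _, _, ⟨c, hc⟩, ⟨d, hd⟩ => ⟨c + d, fun h => congrArg₂ (· + ·) (hc h) (hd h)⟩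
  | p + 1, _, _, hφ, hχ => fun g => by
    obtain ⟨ψ, hψ, hj⟩ := hφ g
    obtain ⟨ω, hω, hj'⟩ := hχ g
    exact ⟨_, hψ.add hω, fun h => (hj h).add (hj' h)⟩

lemma IsPolyMap.bilin (B : L →ₗ[k] V →ₗ[k] V') : ∀ {p : ℕ} {φ : L → V}, IsPolyMap k p φ →
    IsPolyMap k (p + 1) (fun h => B h (φ h))
  | 0, φ, ⟨c, hc⟩ => fun g => by
    refine ⟨fun _ => B g c, ⟨_, fun _ => rfl⟩, fun h => ?_⟩
    simpa [hc] using HasJet.bilin B (HasJet.line (k := k) h g) (HasJet.const c)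
  | p + 1, φ, hφ => fun g => by
    obtain ⟨ψ, hψ, hj⟩ := hφ g
    exact ⟨_, (hψ.bilin B).add (hφ.map (B g)), fun h => HasJet.bilin B (HasJet.line h g) (hj h)⟩

end PolynomialMaps

section DifferentialOperators

variable {k : Type*} [Field k] {A : Type*} [CommRing A] [Algebra k A]

/-- The commutator of a linear operator with the multiplication by `a`. -/
def mulCommutator (F : A →ₗ[k] A) (a : A) : A →ₗ[k] A :=
  F ∘ₗ LinearMap.mulLeft k a - LinearMap.mulLeft k a ∘ₗ F

lemma mulCommutator_apply (F : A →ₗ[k] A) (a b : A) :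
    mulCommutator F a b = F (a * b) - a * F b := rfl

/-- `n`-fold commutators of `F` with multiplication operators vanish. -/
def CommutatorsVanish : ℕ → (A →ₗ[k] A) → Prop
  | 0, F => F = 0
  | n + 1, F => ∀ a, CommutatorsVanish n (mulCommutator F a)

lemma CommutatorsVanish.zero : ∀ n : ℕ, CommutatorsVanish n (0 : A →ₗ[k] A)
  | 0 => rfl
  | n + 1 => fun a => by
    convert CommutatorsVanish.zero n using 1
    ext; simp [mulCommutator_apply]

lemma CommutatorsVanish.succ : ∀ {n : ℕ} {F : A →ₗ[k] A}, CommutatorsVanish n F →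
    CommutatorsVanish (n + 1) F
  | 0, _, h => by rw [show _ = _ from h]; exact .zero _
  | _ + 1, _, h => fun a => (h a).succ

lemma CommutatorsVanish.mono {m n : ℕ} (hmn : m ≤ n) {F : A →ₗ[k] A}
    (h : CommutatorsVanish m F) : CommutatorsVanish n F := by
  induction hmn with
  | refl => exact h
  | step _ ih => exact ih.succ

lemma CommutatorsVanish.add : ∀ {n : ℕ} {F G : A →ₗ[k] A}, CommutatorsVanish n F →
    CommutatorsVanish n G → CommutatorsVanish n (F + G)
  | 0, F, G, hF, hG => by
    rw [show F = 0 from hF, show G = 0 from hG, add_zero]; exact .zero _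
  | n + 1, F, G, hF, hG => fun a => by
    convert (hF a).add (hG a) using 1
    ext; simp [mulCommutator_apply, mul_add]; ring

lemma CommutatorsVanish.smul (c : k) : ∀ {n : ℕ} {F : A →ₗ[k] A}, CommutatorsVanish n F →
    CommutatorsVanish n (c • F)
  | 0, _, hF => by rw [show _ = _ from hF, smul_zero]; exact .zero _
  | n + 1, F, hF => fun a => by
    convert (hF a).smul c using 1
    ext; simp [mulCommutator_apply, smul_sub]

lemma CommutatorsVanish.sum {ι : Type*} (s : Finset ι) {n : ℕ} {F : ι → A →ₗ[k] A}
    (h : ∀ i ∈ s, CommutatorsVanish n (F i)) : CommutatorsVanish n (∑ i ∈ s, F i) :=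
  Finset.sum_induction _ _ (fun _ _ => .add) (.zero n) h

lemma CommutatorsVanish.comp {m n : ℕ} {F G : A →ₗ[k] A} (hF : CommutatorsVanish (m + 1) F)
    (hG : CommutatorsVanish (n + 1) G) : CommutatorsVanish (m + n + 1) (F ∘ₗ G) := by
  induction hN : m + n generalizing m n F G with
  | zero =>
    obtain ⟨rfl, rfl⟩ : m = 0 ∧ n = 0 := by omega
    intro a
    refine LinearMap.ext fun b => ?_
    have h1 := LinearMap.congr_fun (show mulCommutator G a = 0 from hG a) b
    have h2 := LinearMap.congr_fun (show mulCommutator F a = 0 from hF a) (G b)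
    simp only [mulCommutator_apply, LinearMap.zero_apply, sub_eq_zero] at h1 h2
    simp [mulCommutator_apply, h1, h2]
  | succ N ih =>
    intro a
    have key : mulCommutator (F ∘ₗ G) a = F ∘ₗ mulCommutator G a + mulCommutator F a ∘ₗ G := by
      ext; simp [mulCommutator_apply]
    rw [key]
    refine .add ?_ ?_
    · cases n with
      | zero =>
        rw [show mulCommutator G a = 0 from hG a, LinearMap.comp_zero]
        exact .zero _
      | succ n => exact ih hF (hG a) (by omega)
    · cases m with
      | zero =>
        rw [show mulCommutator F a = 0 from hF a, LinearMap.zero_comp]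
        exact .zero _
      | succ m => exact ih (hF a) hG (by omega)

lemma CommutatorsVanish.mulLeft (a : A) : CommutatorsVanish 1 (LinearMap.mulLeft k a) :=
  fun b => LinearMap.ext fun c => by simp [mulCommutator_apply]; ring

lemma CommutatorsVanish.of_adjoin {s : Set A} (hs : Algebra.adjoin k s = ⊤) {n : ℕ}
    {F : A →ₗ[k] A} (h : ∀ a ∈ s, CommutatorsVanish n (mulCommutator F a)) :
    CommutatorsVanish (n + 1) F := by
  intro a
  have ha : a ∈ Algebra.adjoin k s := hs ▸ Algebra.mem_top
  induction ha using Algebra.adjoin_induction with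
  | mem a ha => exact h a ha
  | algebraMap r =>
    convert CommutatorsVanish.zero n using 1
    ext; simp [mulCommutator_apply, Algebra.algebraMap_eq_smul_one]
  | add a b _ _ ha hb =>
    convert ha.add hb using 1
    ext; simp [mulCommutator_apply, add_mul]; ring
  | mul a b _ _ ha hb =>
    have key : mulCommutator F (a * b) =
        mulCommutator F a ∘ₗ LinearMap.mulLeft k b + LinearMap.mulLeft k a ∘ₗ mulCommutator F b := by
      ext; simp [mulCommutator_apply, mul_assoc, mul_sub]
    rw [key]
    cases n with
    | zero =>
      rw [show mulCommutator F a = 0 from ha, show mulCommutator F b = 0 from hb]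
      simpa using CommutatorsVanish.zero 0
    | succ n =>
      refine .add (ha.comp (.mulLeft b)) ?_
      simpa using (CommutatorsVanish.mulLeft (k := k) a).comp hb

lemma CommutatorsVanish.sum_powerset_eq_zero {ι : Type*} [DecidableEq ι] (s : Finset ι)
    {F : A →ₗ[k] A} (hF : CommutatorsVanish s.card F) (a : ι → A) (b : A) :
    ∑ T ∈ s.powerset, (-1 : A) ^ T.card * (∏ i ∈ s \ T, a i) * F ((∏ i ∈ T, a i) * b) = 0 := by
  induction s using Finset.induction_on generalizing F with
  | empty => rw [show F = 0 from hF]; simp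
  | insert j s hj ih =>
    rw [Finset.card_insert_of_notMem hj] at hF
    rw [Finset.sum_powerset_insert hj, ← Finset.sum_add_distrib, ← neg_eq_zero, ← ih (hF (a j)),
      ← Finset.sum_neg_distrib]
    refine Finset.sum_congr rfl fun T hT => ?_
    have hjT : j ∉ T := fun h => hj (Finset.mem_powerset.1 hT h)
    have h1 : insert j s \ T = insert j (s \ T) := Finset.insert_sdiff_of_notMem _ hjT
    have h2 : insert j s \ insert j T = s \ T := by
      ext i; simp only [Finset.mem_sdiff, Finset.mem_insert]
      rcases eq_or_ne i j with rfl | h <;> simp [*]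
    rw [h1, h2, Finset.prod_insert (by simp [hj]), Finset.card_insert_of_notMem hjT,
      Finset.prod_insert hjT, mulCommutator_apply, mul_assoc (a j)]
    ring

end DifferentialOperators

section AdjointExpansion

variable {A : Type*} [Ring A]

lemma pow_mul_eq_sum_antidiagonal {H : A} {X : ℕ → A}
    (hX : ∀ j, H * X j = X j * H + X (j + 1)) (m : ℕ) :
    H ^ m * X 0 = ∑ ij ∈ Finset.HasAntidiagonal.antidiagonal m, m.choose ij.1 • (X ij.1 * H ^ ij.2) := by
  induction m with
  | zero => simp
  | succ m ih =>
    rw [Finset.sum_antidiagonal_choose_succ_nsmul (fun i j => X i * H ^ j), pow_succ', mul_assoc,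
      ih, Finset.mul_sum, ← Finset.sum_add_distrib]
    refine Finset.sum_congr rfl fun ij hij => ?_
    rw [← Nat.choose_symm_of_eq_add (Finset.HasAntidiagonal.mem_antidiagonal.1 hij).symm, mul_smul_comm,
      ← smul_add, ← mul_assoc, hX, add_mul, mul_assoc, ← pow_succ']

lemma sum_pow_mul_pow_eq_sum_antidiagonal {H : A} {X : ℕ → A}
    (hX : ∀ j, H * X j = X j * H + X (j + 1)) (m : ℕ) :
    ∑ i ∈ Finset.range (m + 1), H ^ i * X 0 * H ^ (m - i) =
      ∑ ij ∈ Finset.HasAntidiagonal.antidiagonal m, (m + 1).choose (ij.1 + 1) • (X ij.1 * H ^ ij.2) := by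
  induction m with
  | zero => simp
  | succ m ih =>
    have h1 : ∑ i ∈ Finset.range (m + 1), H ^ i * X 0 * H ^ (m + 1 - i) =
        (∑ i ∈ Finset.range (m + 1), H ^ i * X 0 * H ^ (m - i)) * H := by
      rw [Finset.sum_mul]
      refine Finset.sum_congr rfl fun i hi => ?_
      rw [Nat.succ_sub (Nat.lt_succ_iff.1 (Finset.mem_range.1 hi)), pow_succ, mul_assoc (H ^ i * X 0)]
    have h2 : ∑ ij ∈ Finset.HasAntidiagonal.antidiagonal (m + 1), (m + 1).choose (ij.1 + 1) • (X ij.1 * H ^ ij.2) =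
        (∑ i ∈ Finset.range (m + 1), H ^ i * X 0 * H ^ (m - i)) * H := by
      rw [Finset.Nat.sum_antidiagonal_succ', ih, Finset.sum_mul]
      simp [pow_succ, mul_assoc]
    rw [Finset.sum_range_succ, h1, Nat.sub_self, pow_zero, mul_one,
      pow_mul_eq_sum_antidiagonal hX, ← h2, ← Finset.sum_add_distrib]
    refine Finset.sum_congr rfl fun ij _ => ?_
    rw [Nat.choose_succ_succ (m + 1), add_smul, add_comm]

lemma sum_antidiagonal_bernoulli {k : Type*} [Field k] [CharZero k] (n j : ℕ) :
    ∑ pi ∈ Finset.HasAntidiagonal.antidiagonal n, (bernoulli pi.1 : k) * ((n + j).choose pi.1 : k) *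
      (((pi.2 + j + 1).choose (pi.2 + 1) : k) / (pi.2 + j + 1 : ℕ)) = if n = 0 then 1 else 0 := by
  have h := congrArg (fun q : ℚ => ((n + j).choose n : k) * (q : k)) (bernoulli_spec' n)
  simp only [Rat.cast_sum, Finset.mul_sum] at h
  rw [show (((n + j).choose n : k) * ((if n = 0 then 1 else 0 : ℚ) : k)) =
    if n = 0 then 1 else 0 by split_ifs with h <;> simp [h]] at h
  rw [← h]
  refine Finset.sum_congr rfl fun pi hpi => ?_
  obtain ⟨p, i⟩ := pi
  obtain rfl := (Finset.HasAntidiagonal.mem_antidiagonal.1 hpi)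
  have hf : ∀ n : ℕ, (n.factorial : k) ≠ 0 := fun n => Nat.cast_ne_zero.2 n.factorial_ne_zero
  have h1 : (i + 1 : k) ≠ 0 := by exact_mod_cast Nat.succ_ne_zero i
  have h2 : (i + j + 1 : k) ≠ 0 := by exact_mod_cast Nat.succ_ne_zero (i + j)
  push_cast
  have e1 : ((p + i + j).choose p : k) = (p + i + j).factorial / (p.factorial * (i + j).factorial) := by
    rw [add_assoc, Nat.cast_add_choose]
  have e2 : ((i + j + 1).choose (i + 1) : k) =
      (i + j + 1) * (i + j).factorial / ((i + 1) * i.factorial * j.factorial) := by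
    rw [show i + j + 1 = i + 1 + j by ring, Nat.cast_add_choose, show i + 1 + j = i + j + 1 by ring,
      Nat.factorial_succ, Nat.factorial_succ]
    push_cast
    ring
  have e3 : ((p + i).choose i : k) = (p + i).factorial / (p.factorial * i.factorial) := by
    rw [Nat.choose_symm_add.symm, Nat.cast_add_choose]
  rw [e1, e2, e3, Nat.cast_add_choose]
  field_simp [hf]

end AdjointExpansion

section Symmetrization

variable {k : Type} [Field k] {L : Type} [LieRing L] [LieAlgebra k L]
  {S : Type} [CommRing S] [Algebra k S] {ι : L →ₗ[k] S}

lemma pow_mem_Sdeg (h : L) (n : ℕ) : ι h ^ n ∈ Sdeg k L S ι n :=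
  Submodule.pow_mem_pow _ (LinearMap.mem_range_self ι h) n

lemma pow_mul_mem_Sdeg (h g : L) (n : ℕ) : ι h ^ n * ι g ∈ Sdeg k L S ι (n + 1) := by
  rw [Sdeg, pow_succ]
  exact Submodule.mul_mem_mul (pow_mem_Sdeg h n) (LinearMap.mem_range_self ι g)

lemma IsSymmAlg.induction (hS : IsSymmAlg k L S ι) {P : S → Prop}
    (hadd : ∀ x y, P x → P y → P (x + y)) (hP : ∀ n, ∀ x ∈ Sdeg k L S ι n, P x) (x : S) : P x := by
  have hx : x ∈ Submodule.span k (Submonoid.closure (Set.range ι) : Set S) := by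
    rw [← Algebra.adjoin_eq_span, show Algebra.adjoin k (Set.range ι) = ⊤ from hS]
    trivial
  have hc : ∀ y ∈ Submonoid.closure (Set.range ι), ∃ n, y ∈ Sdeg k L S ι n := by
    intro y hy
    induction hy using Submonoid.closure_induction with
    | mem y hy =>
      obtain ⟨g, rfl⟩ := hy
      exact ⟨1, by simpa using pow_mem_Sdeg (k := k) (ι := ι) g 1⟩
    | one => exact ⟨0, by rw [Sdeg, pow_zero]; exact Submodule.one_le.1 le_rfl⟩
    | mul y z _ _ hy hz =>
      obtain ⟨m, hm⟩ := hy
      obtain ⟨n, hn⟩ := hz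
      exact ⟨m + n, by rw [Sdeg, pow_add]; exact Submodule.mul_mem_mul hm hn⟩
  induction hx using Submodule.closure_induction with
  | zero => exact hP 0 0 (zero_mem _)
  | add x y _ _ hx hy => exact hadd x y hx hy
  | smul_mem c x hx =>
    obtain ⟨n, hn⟩ := hc x hx
    exact hP n _ (Submodule.smul_mem _ c hn)

/-- The comultiplication of the universal enveloping algebra. -/
def envelopingComul (k L : Type) [Field k] [LieRing L] [LieAlgebra k L] :
    UniversalEnvelopingAlgebra k L →ₐ[k]
      TensorProduct k (UniversalEnvelopingAlgebra k L) (UniversalEnvelopingAlgebra k L) :=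
  letI : LieRing (TensorProduct k (UniversalEnvelopingAlgebra k L)
      (UniversalEnvelopingAlgebra k L)) := LieRing.ofAssociativeRing
  UniversalEnvelopingAlgebra.lift k
    { toFun := fun x => UniversalEnvelopingAlgebra.ι k x ⊗ₜ[k] 1 +
        1 ⊗ₜ[k] UniversalEnvelopingAlgebra.ι k x
      map_add' := fun x y => by
        simp only [map_add, TensorProduct.add_tmul, TensorProduct.tmul_add]; abel
      map_smul' := fun c x => by
        simp [TensorProduct.smul_tmul']
      map_lie' := fun {x y} => by
        simp only [LieHom.map_lie, LieRing.of_associative_ring_bracket, TensorProduct.sub_tmul,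
          TensorProduct.tmul_sub, mul_add, add_mul, Algebra.TensorProduct.tmul_mul_tmul, one_mul,
          mul_one]
        abel }

/-- The convolution square of the identity of the universal enveloping algebra. -/
def envelopingAdams (k L : Type) [Field k] [LieRing L] [LieAlgebra k L] :
    UniversalEnvelopingAlgebra k L →ₗ[k] UniversalEnvelopingAlgebra k L :=
  LinearMap.mul' k _ ∘ₗ (envelopingComul k L).toLinearMap

lemma envelopingAdams_pow (h : L) (m : ℕ) :
    envelopingAdams k L (UniversalEnvelopingAlgebra.ι k h ^ m) =
      (2 ^ m : k) • UniversalEnvelopingAlgebra.ι k h ^ m := by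
  have h1 : envelopingComul k L (UniversalEnvelopingAlgebra.ι k h) =
      UniversalEnvelopingAlgebra.ι k h ⊗ₜ[k] 1 + 1 ⊗ₜ[k] UniversalEnvelopingAlgebra.ι k h :=
    UniversalEnvelopingAlgebra.lift_ι_apply k _ h
  have hc : Commute (UniversalEnvelopingAlgebra.ι k h ⊗ₜ[k] (1 : UniversalEnvelopingAlgebra k L))
      (1 ⊗ₜ[k] UniversalEnvelopingAlgebra.ι k h) := by
    simp [Commute, SemiconjBy]
  simp only [envelopingAdams, LinearMap.comp_apply, AlgHom.toLinearMap_apply, map_pow, h1]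
  rw [hc.add_pow, map_sum]
  have h2 : ∀ i ∈ Finset.range (m + 1), LinearMap.mul' k (UniversalEnvelopingAlgebra k L)
      ((UniversalEnvelopingAlgebra.ι k h ⊗ₜ[k] (1 : UniversalEnvelopingAlgebra k L)) ^ i *
        (1 ⊗ₜ[k] UniversalEnvelopingAlgebra.ι k h) ^ (m - i) *
          (m.choose i : TensorProduct k (UniversalEnvelopingAlgebra k L)
            (UniversalEnvelopingAlgebra k L))) =
      m.choose i • UniversalEnvelopingAlgebra.ι k h ^ m := by
    intro i hi
    have him : i + (m - i) = m := by have := Finset.mem_range.1 hi; omega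
    rw [← nsmul_eq_mul', map_nsmul, Algebra.TensorProduct.tmul_pow, Algebra.TensorProduct.tmul_pow,
      Algebra.TensorProduct.tmul_mul_tmul]
    simp [← pow_add, him]
  rw [Finset.sum_congr rfl h2, ← Finset.sum_smul, Nat.sum_range_choose,
    ← Nat.cast_smul_eq_nsmul k]
  simp

lemma isPolyMap_ad_pow (g : L) (p : ℕ) :
    IsPolyMap k p (fun h : L => ((LieAlgebra.ad k L h) ^ p) g) := by
  induction p with
  | zero => exact ⟨g, fun h => by simp⟩
  | succ p ih =>
    convert ih.bilin (LieAlgebra.ad k L : L →ₗ[k] Module.End k L) using 2 with h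
    rw [pow_succ', Module.End.mul_apply]
    rfl

variable [CharZero k]

lemma Sdeg_le_span_pow (n : ℕ) :
    Sdeg k L S ι n ≤ Submodule.span k (Set.range fun h => ι h ^ n) := by
  induction n with
  | zero =>
    rw [Sdeg, pow_zero, Submodule.one_eq_span]
    exact Submodule.span_mono (by rintro _ rfl; exact ⟨0, by simp⟩)
  | succ n ih =>
    rw [Sdeg, pow_succ, Submodule.mul_le]
    rintro x hx _ ⟨g, rfl⟩
    replace hx := ih hx
    induction hx using Submodule.span_induction with
    | mem x hx =>
      obtain ⟨h, rfl⟩ := hx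
      have hmem := ((HasJet.line (k := k) (ι h) (ι g)).pow_comm (n + 1)).mem
        (Submodule.span k (Set.range fun h => ι h ^ (n + 1)))
        (fun t => Submodule.subset_span ⟨h + t • g, by simp⟩)
      exact (Submodule.smul_mem_iff _ (by exact_mod_cast Nat.succ_ne_zero n)).1 hmem
    | zero => simp
    | add x y _ _ hx hy => rw [add_mul]; exact add_mem hx hy
    | smul c x _ hx => rw [smul_mul_assoc]; exact Submodule.smul_mem _ _ hx

lemma IsSymmAlg.linearMap_ext (hS : IsSymmAlg k L S ι) {V : Type*} [AddCommGroup V] [Module k V]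
    {F G : S →ₗ[k] V} (h : ∀ h n, F (ι h ^ n) = G (ι h ^ n)) : F = G := by
  refine LinearMap.ext fun x => hS.induction (P := fun x => F x = G x)
    (fun x y hx hy => by rw [map_add, map_add, hx, hy]) (fun n x hx => ?_) x
  refine LinearMap.eqOn_span (s := Set.range fun h => ι h ^ n) ?_ (Sdeg_le_span_pow n hx)
  rintro _ ⟨g, rfl⟩
  exact h g n

lemma CommutatorsVanish.of_apply_pow (hS : IsSymmAlg k L S ι) {p : ℕ} {φ : L → S}
    (hφ : IsPolyMap k p φ) {F : S →ₗ[k] S}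
    (hF : ∀ h m, F (ι h ^ m) = (m.choose p : k) • (ι h ^ (m - p) * φ h)) :
    CommutatorsVanish (p + 1) F := by
  induction p generalizing φ F with
  | zero =>
    obtain ⟨c, hc⟩ := hφ
    have : F = LinearMap.mulLeft k c :=
      hS.linearMap_ext fun h m => by simp [hF, hc, mul_comm]
    rw [this]
    exact .mulLeft c
  | succ p ih =>
    refine .of_adjoin hS ?_
    rintro _ ⟨g, rfl⟩
    obtain ⟨ψ, hψ, hj⟩ := hφ g
    refine ih (hψ.map ((p + 1 : k)⁻¹ • LinearMap.id)) fun h m => ?_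
    have j1 := ((HasJet.line (k := k) (ι h) (ι g)).pow_comm (m + 1)).map F
    have j2 := ((((HasJet.line (k := k) (ι h) (ι g)).pow_comm (m + 1 - (p + 1))).mul (hj h)).map
      (((m + 1).choose (p + 1) : k) • LinearMap.id))
    have hu := j1.unique (c := _) (d := _) (by
      convert j2 using 1
      ext t
      simpa using hF (h + t • g) (m + 1))
    have hm : (m + 1 : k) ≠ 0 := by exact_mod_cast Nat.succ_ne_zero m
    have hp : (p + 1 : k) ≠ 0 := by exact_mod_cast Nat.succ_ne_zero p
    have hc : ((m + 1).choose (p + 1) : k) = (m + 1) * m.choose p / (p + 1) := by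
      rw [eq_div_iff hp]
      exact_mod_cast (Nat.add_one_mul_choose_eq m p).symm
    have hc' : ((m + 1).choose (p + 1) : k) * (m - p : ℕ) = (m + 1) * m.choose (p + 1) := by
      have := Nat.choose_mul_succ_eq m (p + 1)
      rw [show m + 1 - (p + 1) = m - p by omega] at this
      exact_mod_cast this.symm.trans (mul_comm _ _)
    refine smul_right_injective S hm ?_
    have hu' : F ((m + 1 : k) • (ι g * ι h ^ m)) =
        ((m + 1).choose (p + 1) : k) • (ι h ^ (m - p) * ψ h) +
        (((m + 1).choose (p + 1) : k) * (m - p : ℕ)) • (ι g * (ι h ^ (m - (p + 1)) * φ h)) := by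
      convert hu using 1
      · simp [mul_comm]
      · simp only [show m + 1 - (p + 1) = m - p by omega, show m - p - 1 = m - (p + 1) by omega,
          LinearMap.smul_apply, LinearMap.id_apply, smul_add, smul_mul_assoc, mul_smul]
        congr 3
        ring
    rw [hc', hc] at hu'
    simp only [mulCommutator_apply, smul_sub, ← map_smul F, hu', hF, LinearMap.smul_apply,
      LinearMap.id_apply, mul_smul_comm, smul_smul]
    rw [add_sub_cancel_right]
    congr 1
    field_simp

variable {e : S →ₗ[k] UniversalEnvelopingAlgebra k L}

lemma IsSymmetrization.map_pow (he : IsSymmetrization k L S ι e) (h : L) (m : ℕ) :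
    e (ι h ^ m) = UniversalEnvelopingAlgebra.ι k h ^ m := by
  have key := he (List.replicate m h)
  have hc : ∀ σ : Equiv.Perm (Fin (List.replicate m h).length),
      (List.ofFn fun i => UniversalEnvelopingAlgebra.ι k ((List.replicate m h).get (σ i))).prod =
        UniversalEnvelopingAlgebra.ι k h ^ m := by
    intro σ
    have : ∀ i, (List.replicate m h).get i = h := fun i => by simp
    simp only [this, List.ofFn_const, List.prod_replicate, List.length_replicate]
  rw [Finset.sum_congr rfl fun σ _ => hc σ, Finset.sum_const, Finset.card_univ, Fintype.card_perm,
    Fintype.card_fin, List.length_replicate, List.map_replicate, List.prod_replicate,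
    ← Nat.cast_smul_eq_nsmul k, inv_smul_smul₀ (Nat.cast_ne_zero.2 m.factorial_ne_zero)] at key
  exact key

lemma IsSymmetrization.map_pow_mul (he : IsSymmetrization k L S ι e) (h g : L) (m : ℕ) :
    (m + 1 : k) • e (ι h ^ m * ι g) = ∑ i ∈ Finset.range (m + 1),
      UniversalEnvelopingAlgebra.ι k h ^ i * UniversalEnvelopingAlgebra.ι k g *
        UniversalEnvelopingAlgebra.ι k h ^ (m - i) := by
  have j1 := ((HasJet.line (k := k) (ι h) (ι g)).pow_comm (m + 1)).map e
  have j2 := (HasJet.line (k := k) (UniversalEnvelopingAlgebra.ι k h)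
    (UniversalEnvelopingAlgebra.ι k g)).pow (m + 1)
  have hu := j1.unique (by
    convert j2 using 1
    ext t
    simpa using he.map_pow (h + t • g) (m + 1))
  simpa using hu

lemma IsSymmetrization.ι_mul_map_pow (he : IsSymmetrization k L S ι e) (h g : L) (m : ℕ) :
    UniversalEnvelopingAlgebra.ι k g * e (ι h ^ m) =
      e (∑ p ∈ Finset.range (m + 1), (m.choose p : k) •
        (ι h ^ (m - p) * ((bernoulli p : k) • ι (((LieAlgebra.ad k L h) ^ p) g)))) := by
  set H := UniversalEnvelopingAlgebra.ι k h
  set X : ℕ → UniversalEnvelopingAlgebra k L :=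
    fun j => UniversalEnvelopingAlgebra.ι k (((LieAlgebra.ad k L h) ^ j) g)
  have hX : ∀ j, H * X j = X j * H + X (j + 1) := by
    intro j
    simp only [X, H, pow_succ', Module.End.mul_apply, LieAlgebra.ad_apply, LieHom.map_lie,
      LieRing.of_associative_ring_bracket]
    abel
  have hE : ∀ p r : ℕ, e (ι h ^ r * ι (((LieAlgebra.ad k L h) ^ p) g)) =
      ∑ ij ∈ Finset.HasAntidiagonal.antidiagonal r,
        (((r + 1).choose (ij.1 + 1) : k) / (r + 1 : ℕ)) • (X (p + ij.1) * H ^ ij.2) := by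
    intro p r
    have hr : (r + 1 : k) ≠ 0 := by exact_mod_cast Nat.succ_ne_zero r
    have h1 := he.map_pow_mul h (((LieAlgebra.ad k L h) ^ p) g) r
    have h2 := sum_pow_mul_pow_eq_sum_antidiagonal (X := fun j => X (p + j)) (fun j => hX (p + j)) r
    refine smul_right_injective _ hr (h1.trans (h2.trans ?_))
    simp only [Finset.smul_sum]
    refine Finset.sum_congr rfl fun ij _ => ?_
    rw [← Nat.cast_smul_eq_nsmul k, smul_smul]
    congr 1
    push_cast
    field_simp
  rw [he.map_pow, map_sum]
  have h3 : ∀ p r : ℕ, e (((p + r).choose p : k) •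
      (ι h ^ r * ((bernoulli p : k) • ι (((LieAlgebra.ad k L h) ^ p) g)))) =
      ∑ ij ∈ Finset.HasAntidiagonal.antidiagonal r,
        ((bernoulli p : k) * ((p + r).choose p : k) *
          (((r + 1).choose (ij.1 + 1) : k) / (r + 1 : ℕ))) • (X (p + ij.1) * H ^ ij.2) := by
    intro p r
    rw [mul_smul_comm, smul_smul, map_smul, hE, Finset.smul_sum]
    refine Finset.sum_congr rfl fun ij _ => ?_
    rw [smul_smul, mul_comm (bernoulli p : k)]
  have h4 := Finset.Nat.sum_antidiagonal_eq_sum_range_succ (fun p r => e (((p + r).choose p : k) •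
      (ι h ^ r * ((bernoulli p : k) • ι (((LieAlgebra.ad k L h) ^ p) g))))) m
  have h5 : ∀ p ∈ Finset.range (m + 1), p + (m - p) = m := fun p hp => by
    have := Finset.mem_range.1 hp; omega
  rw [Finset.sum_congr rfl fun p hp => by
    rw [show (m.choose p : k) = ((p + (m - p)).choose p : k) by rw [h5 p hp]], ← h4]
  simp only [h3]
  rw [Finset.sum_sigma']
  have h6 : ∑ qj ∈ Finset.HasAntidiagonal.antidiagonal m,
      ∑ pi ∈ Finset.HasAntidiagonal.antidiagonal qj.1,
        ((bernoulli pi.1 : k) * ((qj.1 + qj.2).choose pi.1 : k) *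
          (((pi.2 + qj.2 + 1).choose (pi.2 + 1) : k) / (pi.2 + qj.2 + 1 : ℕ))) •
            (X qj.1 * H ^ qj.2) = X 0 * H ^ m := by
    simp only [← Finset.sum_smul, sum_antidiagonal_bernoulli]
    rw [Finset.sum_eq_single (0, m)]
    · simp
    · rintro ⟨q, j⟩ hqj hne
      have : q ≠ 0 := by
        rintro rfl
        exact hne (by simpa using hqj)
      simp [this]
    · simp
  rw [Finset.sum_sigma'] at h6
  refine Eq.trans (by simp [X, H]) (h6.symm.trans ?_)
  refine Finset.sum_nbij' (fun ⟨⟨_, j⟩, ⟨p, i⟩⟩ => ⟨(p, i + j), (i, j)⟩)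
    (fun ⟨⟨p, _⟩, ⟨i, j⟩⟩ => ⟨(p + i, j), (p, i)⟩) ?_ ?_ ?_ ?_ ?_
  · rintro ⟨⟨q, j⟩, ⟨p, i⟩⟩ hx
    simp at hx ⊢
    omega
  · rintro ⟨⟨p, r⟩, ⟨i, j⟩⟩ hx
    simp at hx ⊢
    omega
  · rintro ⟨⟨q, j⟩, ⟨p, i⟩⟩ hx
    simp at hx ⊢
    omega
  · rintro ⟨⟨p, r⟩, ⟨i, j⟩⟩ hx
    simp at hx ⊢
    omega
  · rintro ⟨⟨q, j⟩, ⟨p, i⟩⟩ hx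
    simp at hx
    obtain ⟨rfl, rfl⟩ := hx
    simp [add_assoc]

lemma IsSymmetrization.envelopingAdams_map (he : IsSymmetrization k L S ι e) {n : ℕ} {x : S}
    (hx : x ∈ Sdeg k L S ι n) : envelopingAdams k L (e x) = (2 ^ n : k) • e x := by
  refine LinearMap.eqOn_span (f := envelopingAdams k L ∘ₗ e) (g := (2 ^ n : k) • e)
    (s := Set.range fun h => ι h ^ n) ?_ (Sdeg_le_span_pow n hx)
  rintro _ ⟨h, rfl⟩
  simp only [LinearMap.comp_apply, LinearMap.smul_apply, he.map_pow, envelopingAdams_pow]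

lemma IsSymmetrization.eq_zero_of_sum_eq_zero (he : IsSymmetrization k L S ι e)
    (hinj : Function.Injective e) {N : ℕ} {w : ℕ → S}
    (hw : ∀ i ∈ Finset.range N, w i ∈ Sdeg k L S ι i) (h : ∑ i ∈ Finset.range N, w i = 0)
    {i : ℕ} (hi : i < N) : w i = 0 := by
  have hpow : ∀ r : ℕ, ∀ i ∈ Finset.range N,
      ((envelopingAdams k L) ^ r) (e (w i)) = ((2 ^ r : k) ^ i) • e (w i) := by
    intro r i hi
    induction r with
    | zero => simp
    | succ r ih =>
      rw [pow_succ', Module.End.mul_apply, ih, map_smul, he.envelopingAdams_map (hw i hi),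
        smul_smul]
      congr 1
      ring
  have hT : (Set.range fun r : ℕ => (2 ^ r : k)).Infinite := by
    refine Set.infinite_range_of_injective fun a b hab => ?_
    have : (2 : ℕ) ^ a = 2 ^ b := by exact_mod_cast hab
    exact Nat.pow_right_injective le_rfl this
  have h0 : e (w i) = 0 := by
    refine eq_zero_of_sum_pow_smul_eq_zero (v := fun i => e (w i)) hT ?_ hi
    rintro _ ⟨r, rfl⟩
    rw [← Finset.sum_congr rfl (hpow r), ← map_sum, ← map_sum, h, map_zero, map_zero]
  exact hinj (h0.trans (map_zero e).symm)

lemma IsSymmetrization.components_unique (he : IsSymmetrization k L S ι e)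
    (hinj : Function.Injective e) {N : ℕ} {u v : ℕ → S}
    (hu : ∀ p ≤ N, u p ∈ Sdeg k L S ι (N - p)) (hv : ∀ p ≤ N, v p ∈ Sdeg k L S ι (N - p))
    (h : ∑ p ∈ Finset.range (N + 1), u p = ∑ p ∈ Finset.range (N + 1), v p) {p : ℕ}
    (hp : p ≤ N) : u p = v p := by
  have key := he.eq_zero_of_sum_eq_zero hinj (N := N + 1) (w := fun i => u (N - i) - v (N - i))
    (fun i hi => by
      have hi' : N - (N - i) = i := by have := Finset.mem_range.1 hi; omega
      have := sub_mem (hu (N - i) (by omega)) (hv (N - i) (by omega))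
      rwa [hi'] at this)
    (by
      rw [Finset.sum_sub_distrib, sub_eq_zero]
      have hr := fun f : ℕ → S => Finset.sum_range_reflect f (N + 1)
      simp only [Nat.add_sub_cancel] at hr
      rw [hr, hr, h])
    (i := N - p) (by omega)
  simpa [sub_eq_zero, Nat.sub_sub_self hp] using key

variable {B : ℕ → S →ₗ[k] S →ₗ[k] S}

lemma IsPBWComponents.apply_ι_pow (hB : IsPBWComponents k L S ι e B)
    (he : IsSymmetrization k L S ι e) (hinj : Function.Injective e) (p : ℕ) (g h : L) (m : ℕ) :
    B p (ι g) (ι h ^ m) = (m.choose p : k) •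
      (ι h ^ (m - p) * ((bernoulli p : k) • ι (((LieAlgebra.ad k L h) ^ p) g))) := by
  obtain ⟨h1, h2, h3⟩ := hB
  have hg : ι g ∈ Sdeg k L S ι 1 := by simpa using pow_mem_Sdeg (k := k) (ι := ι) g 1
  have hm := pow_mem_Sdeg (k := k) (ι := ι) h m
  rcases lt_or_ge (1 + m) p with hp | hp
  · rw [h2 p 1 m hp _ hg _ hm, Nat.choose_eq_zero_of_lt (by omega)]
    simp
  refine he.components_unique hinj (N := 1 + m) (u := fun p => B p (ι g) (ι h ^ m))
    (v := fun p => (m.choose p : k) •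
      (ι h ^ (m - p) * ((bernoulli p : k) • ι (((LieAlgebra.ad k L h) ^ p) g))))
    (fun p _ => h1 p 1 m _ hg _ hm) (fun p hp => ?_) ?_ hp
  · rcases lt_or_ge m p with hmp | hmp
    · simp [Nat.choose_eq_zero_of_lt hmp]
    · rw [← map_smul, show 1 + m - p = m - p + 1 by omega]
      exact Submodule.smul_mem _ _ (pow_mul_mem_Sdeg _ _ _)
  · refine hinj ?_
    have hg' : e (ι g) = UniversalEnvelopingAlgebra.ι k g := by
      have := he.map_pow g 1
      rwa [pow_one, pow_one] at this
    rw [h3 1 m _ hg _ hm, hg', he.ι_mul_map_pow, add_comm 1 m, Finset.sum_range_succ _ (m + 1)]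
    simp

lemma IsPBWComponents.apply_one (hB : IsPBWComponents k L S ι e B) (hS : IsSymmAlg k L S ι)
    (he : IsSymmetrization k L S ι e) (hinj : Function.Injective e) (p : ℕ) :
    B p 1 = if p = 0 then LinearMap.id else 0 := by
  obtain ⟨h1, h2, h3⟩ := hB
  have h0 : (1 : S) ∈ Sdeg k L S ι 0 := by simpa using pow_mem_Sdeg (k := k) (ι := ι) 0 0
  refine hS.linearMap_ext fun h m => ?_
  have hm := pow_mem_Sdeg (k := k) (ι := ι) h m
  rcases lt_or_ge (0 + m) p with hp | hp
  · rw [h2 p 0 m hp _ h0 _ hm, if_neg (by omega)]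
    rfl
  refine he.components_unique hinj (N := 0 + m) (u := fun p => B p 1 (ι h ^ m))
    (v := fun p => (if p = 0 then LinearMap.id else 0 : S →ₗ[k] S) (ι h ^ m))
    (fun p _ => h1 p 0 m _ h0 _ hm) (fun p hp => ?_) ?_ hp
  · by_cases hp0 : p = 0
    · simpa [hp0] using hm
    · simp [hp0]
  · refine hinj ?_
    have h1' : e 1 = 1 := by
      have := he.map_pow 0 0
      rwa [pow_zero, pow_zero] at this
    rw [h3 0 m _ h0 _ hm, h1', one_mul, Finset.sum_range_succ']
    simp

lemma IsPBWComponents.sum_apply_apply (hB : IsPBWComponents k L S ι e B)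
    (he : IsSymmetrization k L S ι e) (hinj : Function.Injective e) {l n m : ℕ} {x y z : S}
    (hx : x ∈ Sdeg k L S ι l) (hy : y ∈ Sdeg k L S ι n) (hz : z ∈ Sdeg k L S ι m) (p : ℕ) :
    ∑ q ∈ Finset.range (p + 1), B (p - q) (B q x y) z =
      ∑ q ∈ Finset.range (p + 1), B (p - q) x (B q y z) := by
  obtain ⟨h1, h2, h3⟩ := hB
  have hl : ∀ q r, B r (B q x y) z ∈ Sdeg k L S ι (l + n + m - (q + r)) ∧
      (l + n + m < q + r → B r (B q x y) z = 0) := by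
    intro q r
    rcases lt_or_ge (l + n) q with hq | hq
    · simp [h2 q l n hq x hx y hy]
    · have hd := h1 q l n x hx y hy
      refine ⟨?_, fun hr => h2 r _ m (by omega) _ hd z hz⟩
      convert h1 r _ m _ hd z hz using 2
      omega
  have hr : ∀ q r, B r x (B q y z) ∈ Sdeg k L S ι (l + n + m - (q + r)) ∧
      (l + n + m < q + r → B r x (B q y z) = 0) := by
    intro q r
    rcases lt_or_ge (n + m) q with hq | hq
    · simp [h2 q n m hq y hy z hz]
    · have hd := h1 q n m y hy z hz
      refine ⟨?_, fun hr => h2 r l _ (by omega) x hx _ hd⟩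
      convert h1 r l _ x hx _ hd using 2
      omega
  rcases lt_or_ge (l + n + m) p with hp | hp
  · rw [Finset.sum_eq_zero fun q hq => (hl q (p - q)).2
      (by have := Finset.mem_range.1 hq; omega), Finset.sum_eq_zero fun q hq => (hr q (p - q)).2
      (by have := Finset.mem_range.1 hq; omega)]
  refine he.components_unique hinj (N := l + n + m)
    (u := fun p => ∑ q ∈ Finset.range (p + 1), B (p - q) (B q x y) z)
    (v := fun p => ∑ q ∈ Finset.range (p + 1), B (p - q) x (B q y z))
    (fun p hp => Submodule.sum_mem _ fun q hq => ?_)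
    (fun p hp => Submodule.sum_mem _ fun q hq => ?_) (hinj ?_) hp
  · have := (hl q (p - q)).1
    rwa [Nat.add_sub_cancel' (Nat.lt_succ_iff.1 (Finset.mem_range.1 hq))] at this
  · have := (hr q (p - q)).1
    rwa [Nat.add_sub_cancel' (Nat.lt_succ_iff.1 (Finset.mem_range.1 hq))] at this
  rw [Finset.sum_range_diag_flip (l + n + m + 1) fun q r => B r (B q x y) z,
    Finset.sum_range_diag_flip (l + n + m + 1) fun q r => B r x (B q y z), map_sum, map_sum]
  have el : ∀ q ∈ Finset.range (l + n + m + 1),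
      e (∑ r ∈ Finset.range (l + n + m + 1 - q), B r (B q x y) z) = e (B q x y) * e z := by
    intro q _
    rcases lt_or_ge (l + n) q with hq | hq
    · simp [h2 q l n hq x hx y hy]
    · rw [← h3 _ m _ (h1 q l n x hx y hy) z hz,
        show l + n + m + 1 - q = l + n - q + m + 1 by omega]
  have er : ∀ q ∈ Finset.range (l + n + m + 1),
      e (∑ r ∈ Finset.range (l + n + m + 1 - q), B r x (B q y z)) = e x * e (B q y z) := by
    intro q _
    rcases lt_or_ge (n + m) q with hq | hq
    · simp [h2 q n m hq y hy z hz]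
    · rw [← h3 l _ x hx _ (h1 q n m y hy z hz),
        show l + n + m + 1 - q = l + (n + m - q) + 1 by omega]
  have tl : ∑ q ∈ Finset.range (l + n + m + 1), B q x y =
      ∑ q ∈ Finset.range (l + n + 1), B q x y :=
    (Finset.sum_subset (Finset.range_subset_range.2 (by omega)) fun q _ hq =>
      h2 q l n (by simpa using hq) x hx y hy).symm
  have tr : ∑ q ∈ Finset.range (l + n + m + 1), B q y z =
      ∑ q ∈ Finset.range (n + m + 1), B q y z :=
    (Finset.sum_subset (Finset.range_subset_range.2 (by omega)) fun q _ hq =>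
      h2 q n m (by simpa using hq) y hy z hz).symm
  rw [Finset.sum_congr rfl el, Finset.sum_congr rfl er, ← Finset.sum_mul, ← Finset.mul_sum,
    ← map_sum, ← map_sum, tl, tr, h3 l n x hx y hy, h3 n m y hy z hz, mul_assoc]

lemma IsPBWComponents.apply_zero_ι (hB : IsPBWComponents k L S ι e B) (hS : IsSymmAlg k L S ι)
    (he : IsSymmetrization k L S ι e) (hinj : Function.Injective e) (g : L) :
    B 0 (ι g) = LinearMap.mulLeft k (ι g) :=
  hS.linearMap_ext fun h m => by simp [hB.apply_ι_pow he hinj, mul_comm]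

lemma IsPBWComponents.commutatorsVanish_ι (hB : IsPBWComponents k L S ι e B)
    (hS : IsSymmAlg k L S ι) (he : IsSymmetrization k L S ι e) (hinj : Function.Injective e)
    (p : ℕ) (g : L) : CommutatorsVanish (p + 1) (B p (ι g)) :=
  .of_apply_pow hS ((isPolyMap_ad_pow g p).map ((bernoulli p : k) • ι))
    fun h m => by rw [hB.apply_ι_pow he hinj]; rfl

lemma IsPBWComponents.commutatorsVanish_of_mem (hB : IsPBWComponents k L S ι e B)
    (hS : IsSymmAlg k L S ι) (he : IsSymmetrization k L S ι e) (hinj : Function.Injective e)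
    (n : ℕ) : ∀ a ∈ Sdeg k L S ι n, ∀ p, CommutatorsVanish (p + 1) (B p a) := by
  induction n using Nat.strong_induction_on with
  | _ n ih =>
  cases n with
  | zero =>
    intro a ha p
    rw [Sdeg, pow_zero] at ha
    obtain ⟨c, rfl⟩ := Submodule.mem_one.1 ha
    rw [Algebra.algebraMap_eq_smul_one, map_smul, hB.apply_one hS he hinj]
    refine .smul c ?_
    split_ifs with hp
    · subst hp
      have h1 : LinearMap.mulLeft k (1 : S) = LinearMap.id := by ext; simp
      exact h1 ▸ .mulLeft 1
    · exact .zero _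
  | succ n =>
    intro a ha
    rw [Sdeg, pow_succ'] at ha
    induction ha using Submodule.mul_induction_on' with
    | add x _ y _ hx hy => exact fun p => by rw [map_add]; exact (hx p).add (hy p)
    | mem_mul_mem x hx y hy =>
      obtain ⟨g, rfl⟩ := hx
      intro p
      have hg : ι g ∈ Sdeg k L S ι 1 := by simpa using pow_mem_Sdeg (k := k) (ι := ι) g 1
      have key : B p (ι g * y) = ∑ q ∈ Finset.range (p + 1), B (p - q) (ι g) ∘ₗ B q y -
          ∑ q ∈ Finset.range p, B (p - (q + 1)) (B (q + 1) (ι g) y) := by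
        refine hS.linearMap_ext fun h m => ?_
        have hs := hB.sum_apply_apply he hinj hg hy (pow_mem_Sdeg h m) p
        rw [Finset.sum_range_succ', hB.apply_zero_ι hS he hinj] at hs
        simp only [LinearMap.sub_apply, LinearMap.sum_apply, LinearMap.comp_apply]
        rw [← hs]
        simp
      rw [key, sub_eq_add_neg, ← neg_one_smul k]
      refine .add (.sum _ fun q hq => ?_) (.smul _ (.sum _ fun q hq => ?_))
      · have hq := Finset.mem_range.1 hq
        exact ((hB.commutatorsVanish_ι hS he hinj (p - q) g).comp (ih n (by omega) y hy q)).mono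
          (by omega)
      · have hq := Finset.mem_range.1 hq
        exact (ih (1 + n - (q + 1)) (by omega) _ (hB.1 (q + 1) 1 n _ hg y hy) _).mono (by omega)

end Symmetrization

/-- Theorem 2.2 of the paper (first case): for `a ∈ S𝔤` and `p ≥ 1`, the `k`-linear
endomorphism `x ↦ B_p(a, x)` of the symmetric algebra is a differential operator of
order `≤ p`. -/
theorem Bp_left_is_diffOp (k : Type) [Field k] [CharZero k]
    (L : Type) [LieRing L] [LieAlgebra k L]
    (S : Type) [CommRing S] [Algebra k S] (ι : L →ₗ[k] S)
    (hS : IsSymmAlg k L S ι)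
    (e : S →ₗ[k] UniversalEnvelopingAlgebra k L)
    (he : IsSymmetrization k L S ι e) (hbij : Function.Bijective e)
    (B : ℕ → S →ₗ[k] S →ₗ[k] S) (hB : IsPBWComponents k L S ι e B)
    (a : S) (p : ℕ) (hp : 1 ≤ p) :
    IsDiffOpOrderLE k S p (B p a) := by
  intro c b
  have hF : CommutatorsVanish (p + 1) (B p a) :=
    hS.induction (P := fun a => CommutatorsVanish (p + 1) (B p a))
      (fun x y hx hy => by rw [map_add]; exact hx.add hy)
      (fun n x hx => hB.commutatorsVanish_of_mem hS he hbij.injective n x hx p) a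
  have key := CommutatorsVanish.sum_powerset_eq_zero (Finset.univ : Finset (Fin (p + 1)))
    (by rwa [Finset.card_univ, Fintype.card_fin]) c b
  simpa only [Finset.powerset_univ, ← Finset.compl_eq_univ_sdiff] using key

end
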